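/- arXiv:math/0509180 — 6 statements merged into one kernel-verified Lean document; each statement's English description precedes it below -/
import Mathlib

section
/- If $A$ is a commutative noetherian ring of Krull dimension at least $1$, then the formal power series ring $A[[X]]$ is not a projective $A$-module. -/
section SplitEmbedding

variable {A B I : Type*} [CommRing A] [CommRing B] [Algebra A B]

/-- A section of a surjection from a free module onto `ℕ → A`, reduced modulo an ideal, is a map
`ψ` whose kernel consists of sequences lying in the ideal. -/
theorem exists_reduction_of_projective (h : Module.Projective A (ℕ → A)) :
    ∃ ψ : (ℕ → A) →ₗ[A] ((ℕ → A) →₀ B), ∀ x, ψ x = 0 → ∀ n, algebraMap A B (x n) = 0 := by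
  obtain ⟨s, hs⟩ := h.out
  refine ⟨Finsupp.mapRange.linearMap (Algebra.linearMap A B) ∘ₗ s, fun x hx n => ?_⟩
  have hcoef : ∀ i, algebraMap A B (s x i) = 0 := fun i => by
    simpa using DFunLike.congr_fun hx i
  rw [← hs x, Finsupp.linearCombination_apply, Finsupp.sum, Finset.sum_apply, map_sum]
  exact Finset.sum_eq_zero fun i _ => by simp [hcoef]

/-- The images under `ψ` of the sequences supported beyond `m` are not all supported in a given
finite set. -/
theorem exists_apply_ne_zero_notMem [IsNoetherianRing B] [Nontrivial B]
    (hsurj : Function.Surjective (algebraMap A B)) (ψ : (ℕ → A) →ₗ[A] (I →₀ B))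
    (hψ : ∀ x, ψ x = 0 → ∀ n, algebraMap A B (x n) = 0) (m : ℕ) (S : Finset I) :
    ∃ x : ℕ → A, (∀ i < m, x i = 0) ∧ ∃ j ∉ S, ψ x j ≠ 0 := by
  by_contra! hcon
  let v : ℕ → (S → B) := fun k j => ψ (Pi.single (m + k) 1) j
  have hv : LinearIndependent B v := by
    rw [linearIndependent_iff']
    intro s g hg k hk
    choose f hf using fun i => hsurj (g i)
    let x : ℕ → A := ∑ i ∈ s, f i • Pi.single (m + i) 1
    have hx : ∀ i < m, x i = 0 := fun i hi => by
      simp only [x, Finset.sum_apply, Pi.smul_apply]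
      refine Finset.sum_eq_zero fun l _ => ?_
      rw [Pi.single_eq_of_ne (by omega), smul_zero]
    have hψx : ψ x = 0 := by
      ext j
      by_cases hj : j ∈ S
      · have := congr_fun hg ⟨j, hj⟩
        simp only [x, map_sum, map_smul, Finsupp.finsetSum_apply, Finsupp.smul_apply]
        simpa [v, Algebra.smul_def, hf] using this
      · exact hcon x hx j hj
    have := hψ x hψx (m + k)
    rw [← hf k]
    have hxk : x (m + k) = f k := by
      simp only [x, Finset.sum_apply, Pi.smul_apply]
      rw [Finset.sum_eq_single k (fun l _ hl => by
        rw [Pi.single_eq_of_ne (by omega), smul_zero]) (fun h => absurd hk h)]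
      simp
    rwa [hxk] at this
  have := hv.finite_of_isNoetherian
  exact not_finite ℕ

/-- A sequence of sequences `X m`, each vanishing before `m`, can be summed with coefficients `c m`
so that the remainders are divisible by any common divisor of the later coefficients. -/
theorem exists_sum_add_smul (c : ℕ → A) (hc : ∀ m l, m ≤ l → c m ∣ c l) (X : ℕ → ℕ → A)
    (hX : ∀ m, ∀ i < m, X m i = 0) :
    ∃ x : ℕ → A, ∀ m, ∃ y : ℕ → A, x = ∑ l ∈ Finset.range m, c l • X l + c m • y := by
  refine ⟨fun n => ∑ l ∈ Finset.range (n + 1), c l * X l n, fun m => ?_⟩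
  have hdvd : ∀ n, c m ∣ ∑ l ∈ Finset.Ico m (max m (n + 1)), c l * X l n := fun n =>
    Finset.dvd_sum fun l hl => (hc m l (Finset.mem_Ico.1 hl).1).mul_right _
  choose y hy using hdvd
  refine ⟨y, funext fun n => ?_⟩
  simp only [Pi.add_apply, Finset.sum_apply, Pi.smul_apply, smul_eq_mul]
  rw [← hy, Finset.sum_range_add_sum_Ico _ (le_max_left _ _)]
  refine Finset.sum_subset (Finset.range_mono (le_max_right _ _)) fun l _ hl => ?_
  rw [hX l n (by rw [Finset.mem_range] at hl; omega), mul_zero]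

/-- If `B` is a noetherian domain quotient of `A` that is not a field, then every linear map from
`ℕ → A` to a free `B`-module kills a sequence that is nonzero in `B`. -/
theorem exists_apply_eq_zero_algebraMap_ne_zero [IsNoetherianRing B] [IsDomain B]
    (hsurj : Function.Surjective (algebraMap A B)) (hB : ¬ IsField B)
    (ψ : (ℕ → A) →ₗ[A] (I →₀ B)) :
    ∃ x, ψ x = 0 ∧ ∃ n, algebraMap A B (x n) ≠ 0 := by
  classical
  by_contra! hψ
  obtain ⟨a, ha0, hau⟩ := Ring.exists_not_isUnit_of_not_isField hB
  have hkrull : ∀ b : B, b ≠ 0 → ∃ d : A, algebraMap A B d ≠ 0 ∧ ¬ algebraMap A B d ∣ b := by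
    intro b hb
    by_contra! hdiv
    obtain ⟨a', rfl⟩ := hsurj a
    have hmem : b ∈ ⨅ i : ℕ, Ideal.span {algebraMap A B a'} ^ i := by
      rw [Ideal.mem_iInf]
      intro i
      rw [Ideal.span_singleton_pow, Ideal.mem_span_singleton, ← map_pow]
      exact hdiv _ (by rw [map_pow]; exact pow_ne_zero _ ha0)
    rw [Ideal.iInf_pow_eq_bot_of_isDomain _ (by rwa [Ne, Ideal.span_singleton_eq_top])] at hmem
    exact hb hmem
  choose X hX j hjS hj using exists_apply_ne_zero_notMem hsurj ψ hψ
  choose! d hd hdvd using hkrull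
  let S : ℕ → Finset I := fun m => Nat.rec ∅ (fun k T => T ∪ (ψ (X k T)).support) m
  have hS : ∀ m, S (m + 1) = S m ∪ (ψ (X m (S m))).support := fun m => rfl
  have hSmono : Monotone S := monotone_nat_of_le_succ fun m => by
    rw [hS]; exact Finset.subset_union_left
  let D : ℕ → A := fun m => d (ψ (X m (S m)) (j m (S m)))
  let c : ℕ → A := fun m => ∏ l ∈ Finset.range m, D l
  have hc0 : ∀ m, algebraMap A B (c m) ≠ 0 := fun m => by
    rw [map_prod]
    exact Finset.prod_ne_zero_iff.2 fun l _ => hd _ (hj _ _)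
  obtain ⟨x, hx⟩ := exists_sum_add_smul c
    (fun m l hml => Finset.prod_dvd_prod_of_subset _ _ _ (Finset.range_mono hml))
    (fun m => X m (S m)) (fun m => hX m _)
  have hjmem : ∀ m, j m (S m) ∈ S (m + 1) := fun m => by
    rw [hS, Finset.mem_union, Finsupp.mem_support_iff]
    exact Or.inr (hj _ _)
  have hjinj : Function.Injective fun m => j m (S m) := by
    have hlt : ∀ m l, m < l → j m (S m) ≠ j l (S l) := fun m l hml h =>
      hjS l (S l) (h ▸ hSmono hml (hjmem m))
    intro m l h
    by_contra hml
    exact (lt_or_gt_of_ne hml).elim (fun hml => hlt m l hml h) (fun hml => hlt l m hml h.symm)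
  have hne : ∀ m, j m (S m) ∈ (ψ x).support := by
    intro m
    rw [Finsupp.mem_support_iff]
    intro h0
    obtain ⟨y, hy⟩ := hx (m + 1)
    have hprev : ∑ l ∈ Finset.range m, c l • ψ (X l (S l)) (j m (S m)) = 0 := by
      refine Finset.sum_eq_zero fun l hl => ?_
      have hnot : j m (S m) ∉ (ψ (X l (S l))).support := fun h =>
        hjS m (S m) (hSmono (Finset.mem_range.1 hl) (by
          rw [hS]; exact Finset.mem_union_right _ h))
      rw [Finsupp.notMem_support_iff.1 hnot, smul_zero]
    rw [hy, map_add, map_sum] at h0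
    simp only [map_smul, Finsupp.add_apply, Finsupp.finsetSum_apply, Finsupp.smul_apply,
      Finset.sum_range_succ, hprev, zero_add] at h0
    have hcs : c (m + 1) = c m * D m := Finset.prod_range_succ _ _
    rw [hcs, mul_smul, ← smul_add, Algebra.smul_def] at h0
    have h1 := (mul_eq_zero.1 h0).resolve_left (hc0 m)
    rw [Algebra.smul_def] at h1
    refine hdvd _ (hj m (S m)) ⟨-ψ y (j m (S m)), ?_⟩
    rw [mul_neg]
    exact eq_neg_of_add_eq_zero_left h1
  exact (Set.infinite_range_of_injective hjinj)
    ((ψ x).support.finite_toSet.subset (Set.range_subset_iff.2 hne))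

end SplitEmbedding

/-- Formal power series are the same as sequences of coefficients, as modules. -/
noncomputable def powerSeriesLinearEquivFun (A : Type*) [CommRing A] : PowerSeries A ≃ₗ[A] (ℕ → A) where
  toFun f n := PowerSeries.coeff n f
  invFun x := PowerSeries.mk x
  map_add' f g := by ext; simp
  map_smul' r f := by ext; simp
  left_inv f := by ext; simp
  right_inv x := by ext; simp

/-- If `A` is a commutative noetherian ring of Krull dimension at least `1`, then the formal
power series ring `A[[X]]` is not a projective `A`-module. -/
theorem powerSeries_not_projective (A : Type*) [CommRing A] [IsNoetherianRing A]
    (h : 1 ≤ ringKrullDim A) :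
    ¬ Module.Projective A (PowerSeries A) := by
  intro hproj
  obtain ⟨p, hp⟩ : ∃ p : PrimeSpectrum A, ¬ p.asIdeal.IsMaximal := by
    by_contra! hmax
    have : Ring.KrullDimLE 0 A := Ring.krullDimLE_zero_iff.2 fun I hI => hmax ⟨I, hI⟩
    have h0 : ringKrullDim A ≤ 0 := by
      simpa using Ring.krullDimLE_iff.1 this
    exact absurd (h.trans h0) (by norm_num)
  have : Module.Projective A (ℕ → A) := .of_equiv (powerSeriesLinearEquivFun A)
  obtain ⟨ψ, hψ⟩ := exists_reduction_of_projective (B := A ⧸ p.asIdeal) this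
  obtain ⟨x, hx, n, hn⟩ := exists_apply_eq_zero_algebraMap_ne_zero
    Ideal.Quotient.mk_surjective
    (fun hf => hp (Ideal.Quotient.maximal_of_isField _ hf)) ψ
  exact hn (hψ x hx n)
end

section
/- Let $A$ be a commutative ring and $\mathfrak{m} \subseteq A$ a maximal ideal. If $B$ is a flat $A$-module and $M$ is an $\mathfrak{m}$-adically complete $A$-module, then $\mathrm{Ext}^p_A(B, M) = 0$ for all $p \ge 1$. -/
open CategoryTheory

namespace Submodule

variable {A : Type*} [CommRing A] {F : Type*} [AddCommGroup F] [Module A F]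
  (K : Submodule A F) [Module.Flat A (F ⧸ K)]

/-- A submodule of a flat module with flat quotient is flat. -/
theorem flat_of_flat_quotient [Module.Flat A F] : Module.Flat A K := by
  refine Module.Flat.iff_rTensor_preserves_injective_linearMap.mpr
    fun N N' _ _ _ _ f hf ↦ ?_
  have hinj := LinearMap.lTensor_injective_of_exact_of_flat K.mkQ K.mkQ_surjective K.subtype
    K.injective_subtype (LinearMap.exact_subtype_mkQ K)
  have hcomp : Function.Injective (K.subtype.lTensor N' ∘ₗ f.rTensor K) := by
    rw [LinearMap.lTensor_comp_rTensor, ← LinearMap.rTensor_comp_lTensor]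
    exact (Module.Flat.rTensor_preserves_injective_linearMap f hf).comp (hinj N)
  exact Function.Injective.of_comp hcomp

/-- If `F ⧸ K` is flat, then `K ∩ I F = I K` for every ideal `I`. -/
theorem mem_smul_top_of_flat_quotient (I : Ideal A) {x : K}
    (hx : (x : F) ∈ I • (⊤ : Submodule A F)) : x ∈ I • (⊤ : Submodule A K) := by
  have hinj := LinearMap.lTensor_injective_of_exact_of_flat K.mkQ K.mkQ_surjective K.subtype
    K.injective_subtype (LinearMap.exact_subtype_mkQ K) (A ⧸ I)
  rw [← Submodule.Quotient.mk_eq_zero, ← TensorProduct.quotTensorEquivQuotSMul_mk_one_tmul,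
    LinearEquiv.map_eq_zero_iff] at hx ⊢
  exact hinj (by simpa using hx)

/-- If `F ⧸ K` is flat, then linear maps from `K` to modules killed by a maximal ideal extend
to `F`. -/
theorem exists_extension_of_isTorsionBySet (m : Ideal A) [m.IsMaximal]
    {V : Type*} [AddCommGroup V] [Module A V] (hV : Module.IsTorsionBySet A V m)
    (φ : K →ₗ[A] V) : ∃ ψ : F →ₗ[A] V, ψ ∘ₗ K.subtype = φ := by
  have hle : (m • ⊤ : Submodule A K) ≤ LinearMap.ker φ := smul_le.mpr fun a ha x _ ↦ by
    simpa using @hV (φ x) ⟨a, ha⟩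
  let ι : (K ⧸ (m • ⊤ : Submodule A K)) →ₗ[A] F ⧸ (m • ⊤ : Submodule A F) :=
    mapQ _ _ K.subtype (smul_top_le_comap_smul_top m K.subtype)
  have hι : Function.Injective ι := by
    rw [injective_iff_map_eq_zero]
    intro x
    induction x using Submodule.Quotient.induction_on with
    | _ x =>
      simpa [ι] using! K.mem_smul_top_of_flat_quotient m
  have : IsSemisimpleModule A (F ⧸ (m • ⊤ : Submodule A F)) := by
    let _ := Ideal.Quotient.field m
    have hF := Module.isTorsionBySet_quotient_ideal_smul F m
    let _ := hF.module
    exact (hF.semilinearMap.isSemisimpleModule_iff_of_bijective Function.bijective_id).mpr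
      inferInstance
  obtain ⟨h, hh⟩ := IsSemisimpleModule.extension_property ι hι (liftQ _ φ hle)
  refine ⟨h ∘ₗ mkQ _, LinearMap.ext fun x ↦ ?_⟩
  simpa [ι] using LinearMap.congr_fun hh (Submodule.Quotient.mk x)

/-- If `F` is projective and `F ⧸ K` is flat, then an extension of `φ` to `F` modulo `m ^ n` can be
corrected to an extension modulo `m ^ (n + 1)`. -/
theorem exists_approximate_extension_succ [Module.Projective A F] (m : Ideal A) [m.IsMaximal]
    {M : Type*} [AddCommGroup M] [Module A M] (φ : K →ₗ[A] M) (n : ℕ) (g : F →ₗ[A] M)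
    (hg : ∀ x : K, φ x - g x ∈ (m ^ n • ⊤ : Submodule A M)) :
    ∃ g' : F →ₗ[A] M, (∀ x : K, φ x - g' x ∈ (m ^ (n + 1) • ⊤ : Submodule A M)) ∧
      ∀ x, g' x - g x ∈ (m ^ n • ⊤ : Submodule A M) := by
  set N : Submodule A M := m ^ n • ⊤ with hN
  let δ : K →ₗ[A] N := (φ - g ∘ₗ K.subtype).codRestrict N hg
  obtain ⟨u, hu⟩ := K.exists_extension_of_isTorsionBySet m
    (Module.isTorsionBySet_quotient_ideal_smul N m) (mkQ _ ∘ₗ δ)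
  obtain ⟨v, hv⟩ := Module.projective_lifting_property (mkQ (m • ⊤ : Submodule A N)) u
    (mkQ_surjective _)
  refine ⟨g + N.subtype ∘ₗ v, fun x ↦ ?_, fun x ↦ by simp⟩
  have hx : δ x - v x ∈ (m • ⊤ : Submodule A N) := by
    rw [← Submodule.Quotient.mk_eq_zero, Submodule.Quotient.mk_sub, sub_eq_zero]
    exact (LinearMap.congr_fun hu x).symm.trans (LinearMap.congr_fun hv x).symm
  have := mem_map_of_mem (f := N.subtype) hx
  rw [map_smul'', map_top, range_subtype] at this
  rw [pow_succ', mul_smul, ← hN]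
  rw [LinearMap.add_apply, ← sub_sub]
  exact this

/-- If `F` is projective and `F ⧸ K` is flat, then linear maps from `K` to modules that are adically
complete for a maximal ideal extend to `F`. -/
theorem exists_extension_of_isAdicComplete [Module.Projective A F] (m : Ideal A) [m.IsMaximal]
    {M : Type*} [AddCommGroup M] [Module A M] [IsAdicComplete m M] (φ : K →ₗ[A] M) :
    ∃ ψ : F →ₗ[A] M, ψ ∘ₗ K.subtype = φ := by
  choose! s hs hs' using K.exists_approximate_extension_succ m φ
  let g : ℕ → F →ₗ[A] M := fun n ↦ n.rec 0 s
  have hg (n : ℕ) : ∀ x : K, φ x - g n x ∈ (m ^ n • ⊤ : Submodule A M) := by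
    induction n with
    | zero => simp
    | succ n ih => exact hs n _ ih
  have hc {n : ℕ} : factorPow m M (strictMono_id.monotone n.le_succ) ∘ₗ
      (mkQ (m ^ (n + 1) • ⊤ : Submodule A M) ∘ₗ g (n + 1)) = mkQ _ ∘ₗ g n :=
    LinearMap.ext fun x ↦ (Submodule.Quotient.eq _).mpr (hs' n (g n) (hg n) x)
  refine ⟨IsAdicComplete.StrictMono.lift m strictMono_id (fun n ↦ mkQ _ ∘ₗ g n) hc, ?_⟩
  ext x
  refine IsHausdorff.eq_iff_smodEq (I := m) |>.mpr fun n ↦ ?_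
  exact (IsAdicComplete.StrictMono.mk_lift m strictMono_id _ hc (n := n) (x : F)).trans
    ((Submodule.Quotient.eq _).mpr (hg n x)).symm

end Submodule

namespace CategoryTheory.ProjectiveResolution

variable {A : Type} [CommRing A] {X : ModuleCat.{0} A}

/-- The syzygies of a flat module are flat. -/
theorem flat_quotient_range_d [Module.Flat A X] (P : ProjectiveResolution X) (n : ℕ) :
    Module.Flat A (P.complex.X n ⧸ LinearMap.range (P.complex.d (n + 1) n).hom) := by
  induction n with
  | zero =>
    have h := P.exact₀.moduleCat_range_eq_ker
    have hs : Function.Surjective (P.π.f 0).hom := (ModuleCat.epi_iff_surjective _).mp inferInstance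
    have : Module.Flat A (((ChainComplex.single₀ (ModuleCat A)).obj X).X 0) :=
      inferInstanceAs (Module.Flat A X)
    exact Module.Flat.of_linearEquiv ((Submodule.quotEquivOfEq _ _ h).trans
      ((P.π.f 0).hom.quotKerEquivOfSurjective hs))
  | succ n ih =>
    have h := (P.exact_succ n).moduleCat_range_eq_ker
    have : Module.Projective A (P.complex.X n) :=
      (IsProjective.iff_projective _).mpr (P.projective n)
    have := Submodule.flat_of_flat_quotient (LinearMap.range (P.complex.d (n + 1) n).hom)
    exact Module.Flat.of_linearEquiv ((Submodule.quotEquivOfEq _ _ h).trans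
      (P.complex.d (n + 1) n).hom.quotKerEquivRange)

end CategoryTheory.ProjectiveResolution

/-- Let `A` be a commutative ring and `m ⊆ A` a maximal ideal. If `B` is a flat `A`-module and
`M` is an `m`-adically complete `A`-module, then `Ext^p_A(B, M) = 0` for all `p ≥ 1`. -/
theorem ext_eq_zero_of_flat_of_adicComplete (A : Type) [CommRing A] (m : Ideal A) [m.IsMaximal]
    (B : Type) [AddCommGroup B] [Module A B] [Module.Flat A B]
    (M : Type) [AddCommGroup M] [Module A M] [IsAdicComplete m M]
    (p : ℕ) (hp : 1 ≤ p) :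
    Subsingleton (((Ext A (ModuleCat A) p).obj
      (Opposite.op (ModuleCat.of A B))).obj (ModuleCat.of A M)) := by
  obtain ⟨n, rfl⟩ := Nat.exists_eq_add_of_le' hp
  let P := projectiveResolution (ModuleCat.of A B)
  refine ModuleCat.subsingleton_of_isZero (.of_iso ?_ (P.isoExt (n + 1) (ModuleCat.of A M)))
  rw [← HomologicalComplex.exactAt_iff_isZero_homology,
    HomologicalComplex.exactAt_iff' _ n (n + 1) (n + 2) (by simp) (by simp),
    ShortComplex.moduleCat_exact_iff]
  intro φ hφ
  change P.complex.X (n + 1) ⟶ ModuleCat.of A M at φ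
  replace hφ : P.complex.d (n + 2) (n + 1) ≫ φ = 0 := hφ
  let d := (P.complex.d (n + 1) n).hom
  have hker : LinearMap.ker d.rangeRestrict ≤ LinearMap.ker φ.hom := by
    rw [LinearMap.ker_rangeRestrict, ← (P.exact_succ n).moduleCat_range_eq_ker]
    rintro _ ⟨x, rfl⟩
    exact ConcreteCategory.congr_hom hφ x
  have := P.flat_quotient_range_d n
  have : Module.Projective A (P.complex.X n) :=
    (IsProjective.iff_projective _).mpr (P.projective n)
  obtain ⟨ψ, hψ⟩ := (LinearMap.range d).exists_extension_of_isAdicComplete m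
    ((LinearMap.ker d.rangeRestrict).liftQ φ.hom hker ∘ₗ
      (d.rangeRestrict.quotKerEquivOfSurjective d.surjective_rangeRestrict).symm)
  refine ⟨ModuleCat.ofHom ψ, ?_⟩
  change P.complex.d (n + 1) n ≫ ModuleCat.ofHom ψ = φ
  ext x
  have hx := LinearMap.congr_fun hψ (d.rangeRestrict x)
  rw [LinearMap.comp_apply, LinearMap.comp_apply, LinearEquiv.coe_coe,
    ← LinearMap.quotKerEquivOfSurjective_apply_mk _ d.surjective_rangeRestrict,
    LinearEquiv.symm_apply_apply] at hx
  exact hx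
end

section
/- Let $(A, \mathfrak{m})$ be a commutative local ring whose maximal ideal is nilpotent, i.e. $\mathfrak{m}^n = 0$ for some $n \ge 1$. Then every flat $A$-module is free. -/
/-- **Nakayama's lemma** for a nilpotent ideal, without any finiteness assumption. -/
theorem Submodule.eq_top_of_sup_smul_top_of_pow_eq_bot {R M : Type*} [CommRing R]
    [AddCommGroup M] [Module R M] {I : Ideal R} {n : ℕ} (hI : I ^ n = ⊥) {N : Submodule R M}
    (hN : N ⊔ I • ⊤ = ⊤) : N = ⊤ := by
  have key (k : ℕ) : N ⊔ I ^ k • ⊤ = ⊤ := by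
    induction k with
    | zero => simp
    | succ k ih =>
      refine top_unique (hN.ge.trans (sup_le le_sup_left ?_))
      conv_lhs => rw [← ih]
      rw [Submodule.smul_sup, ← Submodule.mul_smul, ← pow_succ']
      exact sup_le_sup_right Submodule.smul_le_right _
  simpa [hI] using key n

open IsLocalRing in
/-- Over a local ring with nilpotent maximal ideal, elements whose images span the reduction
modulo the maximal ideal span the module. -/
theorem IsLocalRing.span_eq_top_of_span_residueField_tensorProduct_eq_top {R M ι : Type*}
    [CommRing R] [IsLocalRing R] [AddCommGroup M] [Module R M] {n : ℕ}
    (hR : maximalIdeal R ^ n = ⊥) {v : ι → M}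
    (hv : Submodule.span (ResidueField R)
      (Set.range (TensorProduct.mk R (ResidueField R) M 1 ∘ v)) = ⊤) :
    Submodule.span R (Set.range v) = ⊤ := by
  refine Submodule.eq_top_of_sup_smul_top_of_pow_eq_bot hR ?_
  have hmap : (Submodule.span R (Set.range v)).map
      (TensorProduct.mk R (ResidueField R) M 1) = ⊤ := by
    rw [Submodule.map_span, ← Set.range_comp,
      ← Submodule.restrictScalars_span R (ResidueField R) Ideal.Quotient.mk_surjective, hv,
      Submodule.restrictScalars_top]
  have hker : LinearMap.ker (TensorProduct.mk R (ResidueField R) M 1) =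
      maximalIdeal R • (⊤ : Submodule R M) :=
    LinearMap.ker_tensorProductMk M
  rw [← hker, ← Submodule.comap_map_eq, hmap, Submodule.comap_top]

/-- Over a commutative local ring whose maximal ideal is nilpotent, every flat module is free. -/
theorem flat_implies_free_of_nilpotent_maximalIdeal (A : Type*) [CommRing A] [IsLocalRing A]
    (n : ℕ) (hn : 1 ≤ n) (h : IsLocalRing.maximalIdeal A ^ n = ⊥)
    (B : Type*) [AddCommGroup B] [Module A B] [Module.Flat A B] :
    Module.Free A B := by
  let w := Module.Free.chooseBasis (IsLocalRing.ResidueField A)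
    (TensorProduct A (IsLocalRing.ResidueField A) B)
  obtain ⟨v, hv⟩ := (TensorProduct.mk_surjective A B (IsLocalRing.ResidueField A)
    Ideal.Quotient.mk_surjective).comp_left w
  have hv' : TensorProduct.mk A (IsLocalRing.ResidueField A) B 1 ∘ v = w := hv
  refine .of_basis (.mk (Module.IsLocalRing.linearIndependent_of_flat v ?_)
    (IsLocalRing.span_eq_top_of_span_residueField_tensorProduct_eq_top h ?_).ge)
  · rw [hv']
    exact w.linearIndependent
  · rw [hv', w.span_eq]
end

section
/- Let $A$ be a commutative integral domain. Then the family of power series $F_a := \sum_{i=0}^{\infty} a^i X^i$, indexed by the nonzero elements $a \in A \setminus \{0\}$, is linearly independent over $A$ in $A[[X]]$. -/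
/-- Let `A` be a commutative integral domain. The family of power series
`F_a = ∑ᵢ aⁱ Xⁱ`, indexed by the nonzero elements `a ∈ A`, is linearly independent over `A`
in `A[[X]]`. -/
theorem linearIndependent_geometric_powerSeries (A : Type*) [CommRing A] [IsDomain A] :
    LinearIndependent A
      (fun a : {a : A // a ≠ 0} => PowerSeries.mk (fun i => (a : A) ^ i)) := by
  have h := (linearIndependent_monoidHom (Multiplicative ℕ) A).comp
    (fun a : {a : A // a ≠ 0} => powersHom A (a : A))
    ((powersHom A).injective.comp Subtype.val_injective)
  refine LinearIndependent.of_comp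
    (LinearMap.pi fun n : Multiplicative ℕ => PowerSeries.coeff (R := A) n.toAdd) ?_
  convert h using 1
  · ext a n
    simp
  · rfl
end

section
/- Let $A$ be an uncountable commutative integral domain with field of fractions $K$. Then the $K$-vector space $A[[X]] \otimes_A K$ has uncountable dimension; consequently, there is no injective $A$-linear map from $A[[X]]$ into a free $A$-module $A^{(J)}$ on a countable index set $J$. -/
open scoped TensorProduct

attribute [local instance] Algebra.TensorProduct.rightAlgebra

/-- The geometric series `∑ aⁿ Xⁿ`, for `a` in a domain `A`, are linearly independent over `A`. -/
theorem PowerSeries.linearIndependent_mk_pow (A : Type*) [CommRing A] [IsDomain A] :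
    LinearIndependent A fun a : A ↦ PowerSeries.mk fun n ↦ a ^ n := by
  have h := (linearIndependent_monoidHom (Multiplicative ℕ) A).comp (powersHom A)
    (powersHom A).injective
  let coeffs : PowerSeries A →ₗ[A] Multiplicative ℕ → A :=
    LinearMap.pi fun n ↦ PowerSeries.coeff n.toAdd
  refine LinearIndependent.of_comp coeffs ?_
  convert h using 1
  ext a n
  simp [coeffs]

/-- Linear independence over a domain is preserved by `m ↦ m ⊗ 1` into the base change to the
field of fractions. -/
theorem LinearIndependent.tmul_one_of_isFractionRing {A S ι : Type*} [CommRing A] [IsDomain A]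
    [CommRing S] [Algebra A S] (K : Type*) [Field K] [Algebra A K] [IsFractionRing A K]
    {v : ι → S} (hv : LinearIndependent A v) :
    LinearIndependent K fun i ↦ v i ⊗ₜ[A] (1 : K) := by
  have := IsLocalizedModule.of_linearEquiv (nonZeroDivisors A) (TensorProduct.mk A K S 1)
    (TensorProduct.comm A K S)
  exact hv.of_isLocalizedModule K (nonZeroDivisors A)
    ((TensorProduct.comm A K S).toLinearMap ∘ₗ TensorProduct.mk A K S 1)

/-- Let `A` be an uncountable commutative integral domain with field of fractions `K`. Then the
`K`-vector space `A[[X]] ⊗_A K` has uncountable dimension; consequently, there is no injective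
`A`-linear map from `A[[X]]` into a free `A`-module on a countable index set. -/
theorem powerSeries_rank_uncountable_and_no_embedding (A : Type) [CommRing A] [IsDomain A]
    [Uncountable A] (K : Type) [Field K] [Algebra A K] [IsFractionRing A K] :
    Cardinal.aleph0 < Module.rank K (PowerSeries A ⊗[A] K) ∧
      ∀ (J : Type) [Countable J],
        ∀ φ : PowerSeries A →ₗ[A] (J →₀ A), ¬ Function.Injective φ := by
  have hA : Cardinal.aleph0 < Cardinal.mk A := Cardinal.aleph0_lt_mk_iff.mpr inferInstance
  have hv := PowerSeries.linearIndependent_mk_pow A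
  refine ⟨hA.trans_le (hv.tmul_one_of_isFractionRing K).cardinal_le_rank, fun J _ φ hφ ↦ ?_⟩
  have h := (hv.map' φ (LinearMap.ker_eq_bot.mpr hφ)).cardinal_le_rank
  rw [rank_finsupp_self'] at h
  exact (hA.trans_le h).not_ge Cardinal.mk_le_aleph0
end

section
/- Let $A$ be a commutative ring, $\mathfrak{m} \subseteq A$ a maximal ideal, $B$ a flat $A$-module, and $M$ any $A$-module. Then for every $n \ge 0$ the natural map $\mathrm{Hom}_A(B, M/\mathfrak{m}^{n+1} M) \to \mathrm{Hom}_A(B, M/\mathfrak{m}^n M)$, induced by the canonical surjection $M/\mathfrak{m}^{n+1} M \to M/\mathfrak{m}^n M$, is surjective. -/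
/-- The kernel of `P → (R ⧸ I) ⊗ P` is contained in `I • P`. -/
theorem TensorProduct.ker_mk_quotient_one_le {R : Type*} [CommRing R] (I : Ideal R) (P : Type*)
    [AddCommGroup P] [Module R P] :
    LinearMap.ker (TensorProduct.mk R (R ⧸ I) P 1) ≤ I • (⊤ : Submodule R P) := by
  intro x hx
  have h := congrArg (quotTensorEquivQuotSMul P I) (LinearMap.mem_ker.mp hx)
  have h' := quotTensorEquivQuotSMul_mk_tmul I 1 x
  rw [map_one, one_smul] at h'
  rw [map_zero, TensorProduct.mk_apply, h'] at h
  exact (Submodule.Quotient.mk_eq_zero _).mp h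

open TensorProduct IsLocalRing in
/-- A flat module over a local ring with nilpotent maximal ideal is free. -/
theorem Module.free_of_flat_of_isNilpotent_maximalIdeal (R : Type*) [CommRing R] [IsLocalRing R]
    (hR : IsNilpotent (maximalIdeal R)) (P : Type*) [AddCommGroup P] [Module R P]
    [Module.Flat R P] : Module.Free R P := by
  let w := Module.Free.chooseBasis (ResidueField R) (ResidueField R ⊗[R] P)
  obtain ⟨v, hv⟩ :=
    (TensorProduct.mk_surjective R P (ResidueField R) Ideal.Quotient.mk_surjective).comp_left w
  refine .of_basis (.mk (IsLocalRing.linearIndependent_of_flat v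
    (by rw [show _ ∘ v = w from hv]; exact w.linearIndependent)) ?_)
  set N := Submodule.span R (Set.range v)
  have hmap : N.map (TensorProduct.mk R (ResidueField R) P 1) = ⊤ := by
    rw [Submodule.map_span, ← Set.range_comp, show _ ∘ v = w from hv,
      ← Submodule.restrictScalars_span R (ResidueField R) Ideal.Quotient.mk_surjective,
      w.span_eq, Submodule.restrictScalars_top]
  have hker : LinearMap.ker (TensorProduct.mk R (ResidueField R) P 1) ≤
      maximalIdeal R • (⊤ : Submodule R P) :=
    TensorProduct.ker_mk_quotient_one_le (maximalIdeal R) P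
  have hsup : N ⊔ maximalIdeal R • ⊤ = ⊤ := by
    have h := Submodule.comap_map_eq (TensorProduct.mk R (ResidueField R) P 1) N
    rw [hmap, Submodule.comap_top] at h
    exact top_le_iff.mp (h.le.trans (sup_le_sup_left hker N))
  have hpow (k : ℕ) : N ⊔ maximalIdeal R ^ k • ⊤ = ⊤ := by
    induction k with
    | zero => simp
    | succ k ih =>
      refine top_le_iff.mp (hsup.symm.le.trans (sup_le le_sup_left ?_))
      conv_lhs => rw [← ih]
      rw [Submodule.smul_sup, pow_succ', mul_smul]
      exact sup_le_sup_right Submodule.smul_le_right _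
  obtain ⟨k, hk⟩ := hR
  rw [← hpow k, hk]
  simp

/-- The quotient of a ring by a positive power of a maximal ideal is local. -/
theorem Ideal.isLocalRing_quotient_pow {A : Type*} [CommRing A] (m : Ideal A) [m.IsMaximal]
    {n : ℕ} (hn : n ≠ 0) : IsLocalRing (A ⧸ m ^ n) := by
  refine .of_unique_max_ideal ⟨m.map (Ideal.Quotient.mk (m ^ n)), ?_, fun J hJ => ?_⟩
  · exact Ideal.IsMaximal.map_of_surjective_of_ker_le Ideal.Quotient.mk_surjective
      (by rw [Ideal.mk_ker]; exact Ideal.pow_le_self hn)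
  · have hJ' : (J.comap (Ideal.Quotient.mk (m ^ n))).IsMaximal :=
      haveI := hJ
      Ideal.comap_isMaximal_of_surjective _ Ideal.Quotient.mk_surjective
    have hle : m ≤ J.comap (Ideal.Quotient.mk (m ^ n)) := by
      refine hJ'.isPrime.le_of_pow_le (n := n) fun x hx => ?_
      rw [Ideal.mem_comap, Ideal.Quotient.eq_zero_iff_mem.mpr hx]
      exact J.zero_mem
    exact (Ideal.map_comap_of_surjective _ Ideal.Quotient.mk_surjective J).symm.trans
      (congrArg _ (Ideal.IsMaximal.eq_of_le ‹_› hJ'.ne_top hle).symm)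

/-- The base change of a flat module to the quotient by a power of a maximal ideal is
projective. -/
theorem Module.Flat.projective_quotient_pow_tensorProduct {A : Type*} [CommRing A] (m : Ideal A)
    [m.IsMaximal] (B : Type*) [AddCommGroup B] [Module A B] [Module.Flat A B] {n : ℕ}
    (hn : n ≠ 0) : Module.Projective (A ⧸ m ^ n) (TensorProduct A (A ⧸ m ^ n) B) := by
  have := m.isLocalRing_quotient_pow hn
  have hmax : IsLocalRing.maximalIdeal (A ⧸ m ^ n) = m.map (Ideal.Quotient.mk (m ^ n)) :=
    (IsLocalRing.eq_maximalIdeal (Ideal.IsMaximal.map_of_surjective_of_ker_le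
      Ideal.Quotient.mk_surjective (by rw [Ideal.mk_ker]; exact Ideal.pow_le_self hn))).symm
  have := Module.free_of_flat_of_isNilpotent_maximalIdeal (A ⧸ m ^ n)
    ⟨n, by rw [hmax, ← Ideal.map_pow, Ideal.map_quotient_self, Ideal.zero_eq_bot]⟩
    (TensorProduct A (A ⧸ m ^ n) B)
  infer_instance

/-- If the base change of `B` to a quotient ring `A ⧸ I` is projective, then maps out of `B` lift
along surjections of modules killed by `I`. -/
theorem LinearMap.exists_comp_eq_of_projective_quotient_tensorProduct {A : Type*} [CommRing A]
    (I : Ideal A) {B X Y : Type*} [AddCommGroup B] [Module A B] [AddCommGroup X] [Module A X]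
    [AddCommGroup Y] [Module A Y] [Module.Projective (A ⧸ I) (TensorProduct A (A ⧸ I) B)]
    (hX : Module.IsTorsionBySet A X I) (hY : Module.IsTorsionBySet A Y I)
    (p : X →ₗ[A] Y) (hp : Function.Surjective p) (f : B →ₗ[A] Y) :
    ∃ g : B →ₗ[A] X, p ∘ₗ g = f := by
  let := hX.module
  let := hY.module
  have : IsScalarTower A (A ⧸ I) X := hX.isScalarTower
  have : IsScalarTower A (A ⧸ I) Y := hY.isScalarTower
  obtain ⟨g, hg⟩ := Module.projective_lifting_property
    (p.extendScalarsOfSurjective (Ideal.Quotient.mk_surjective (I := I)))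
    (f.liftBaseChange (A ⧸ I)) hp
  refine ⟨(g.restrictScalars A) ∘ₗ TensorProduct.mk A (A ⧸ I) B 1, LinearMap.ext fun b => ?_⟩
  simpa using LinearMap.congr_fun hg (1 ⊗ₜ[A] b)


/-- Let `A` be a commutative ring, `m ⊆ A` a maximal ideal, `B` a flat `A`-module, and `M` any
`A`-module. Then for every `n ≥ 0` the natural map
`Hom_A(B, M/m^(n+1)M) → Hom_A(B, M/m^n M)`, induced by the canonical surjection
`M/m^(n+1)M → M/m^n M`, is surjective. -/
theorem hom_restriction_surjective (A : Type*) [CommRing A] (m : Ideal A) [m.IsMaximal]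
    (B : Type*) [AddCommGroup B] [Module A B] [Module.Flat A B]
    (M : Type*) [AddCommGroup M] [Module A M] (n : ℕ) :
    Function.Surjective
      (fun (g : B →ₗ[A] M ⧸ (m ^ (n + 1) • (⊤ : Submodule A M))) =>
        (Submodule.mapQ (m ^ (n + 1) • (⊤ : Submodule A M)) (m ^ n • (⊤ : Submodule A M))
            LinearMap.id
            (by simpa using Submodule.smul_mono_left (Ideal.pow_le_pow_right (Nat.le_succ n)))).comp
          g) := by
  intro f
  have := Module.Flat.projective_quotient_pow_tensorProduct m B n.succ_ne_zero
  have htors {k : ℕ} (hk : k ≤ n + 1) : Module.IsTorsionBySet A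
      (M ⧸ (m ^ k • (⊤ : Submodule A M))) (m ^ (n + 1) : Ideal A) := by
    rintro x ⟨a, ha⟩
    obtain ⟨x, rfl⟩ := Submodule.Quotient.mk_surjective _ x
    exact (Submodule.Quotient.mk_eq_zero _).mpr
      (Submodule.smul_mem_smul (Ideal.pow_le_pow_right hk ha) trivial)
  refine LinearMap.exists_comp_eq_of_projective_quotient_tensorProduct (m ^ (n + 1))
    (htors le_rfl) (htors n.le_succ) _ (fun y => ?_) f
  obtain ⟨y, rfl⟩ := Submodule.Quotient.mk_surjective _ y
  exact ⟨Submodule.Quotient.mk y, rfl⟩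
end
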